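/- In any execution of the AGS coding scheme Π (Algorithms 3–4) on inputs (x,y): for every round i such that Bob has not entered the termination phase before round i, r_A(i) ≥ (i−1) − c_ch(i). -/

import Mathlib

/-!
Model of the AGS coding scheme Π (Algorithms 3–4) of "Interactive coding resilient to
an unknown number of erasures".  A noiseless alternating binary protocol `π` of length
`N` is given by next-bit functions `fA fB : List Bool → Bool` (`fA t = π(x∣t)` on
even-length transcripts, `fB t = π(y∣t)` on odd-length transcripts).
Rounds are 1-indexed; round `i` consists of two timesteps whose erasures are given by
`(E i).1` (odd timestep, Alice → Bob) and `(E i).2` (even timestep, Bob → Alice).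
In each timestep the sender either transmits a symbol `(b, ρ) ∈ {0,1}×{0,1}` or stays
silent (`□`); a reception is `none` (= the erasure mark ⊥) or `some` of a symbol.
-/

namespace AGS

/-- A transmitted symbol: a message `(bit, parity)`, or silence `□`. -/
inductive Sym where
  | msg : Bool → Bool → Sym
  | sil : Sym
deriving DecidableEq

/-- The word (information-bit content) of a symbol: one bit for a message, the empty
word for silence. -/
def symWord : Sym → List Bool
  | Sym.msg b _ => [b]
  | Sym.sil => []

/-- Parity of a round number, as a Boolean. -/
def par (r : ℕ) : Bool := decide (r % 2 = 1)

/-- Joint state at the beginning of a round: Alice's transcript `TA`, counter `rA`,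
flag `abot` (her last reception was ⊥); Bob's transcript `TB`, counter `rB`, and
stored bit `bsend`. -/
structure St where
  TA : List Bool
  rA : ℕ
  abot : Bool
  TB : List Bool
  rB : ℕ
  bsend : Bool
deriving DecidableEq

/-- The initial state. -/
def init : St := ⟨[], 0, false, [], 0, false⟩

/-- The symbol Alice sends in the odd timestep of a round (silence if her last
reception was erased, and implicit silence after she has terminated). -/
def sentA (fA : List Bool → Bool) (N : ℕ) (s : St) : Sym :=
  if s.rA < N / 2 then
    if s.abot then Sym.sil else Sym.msg (fA s.TA) (par (s.rA + 1))
  else Sym.sil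

/-- Bob's reception in the odd timestep (`none` = erasure mark ⊥). -/
def recvB (fA : List Bool → Bool) (N : ℕ) (e1 : Bool) (s : St) : Option Sym :=
  if e1 then none else some (sentA fA N s)

/-- Bob's update of `TB, rB, bsend` in the odd timestep, given his reception. -/
def bobUpd (fB : List Bool → Bool) (N : ℕ) (r : Option Sym) (s : St) : St :=
  if s.rB < N / 2 then
    match r with
    | some (Sym.msg b p) =>
        if p = par (s.rB + 1) then
          { s with rB := s.rB + 1, bsend := fB (s.TB ++ [b]),
                   TB := (s.TB ++ [b]) ++ [fB (s.TB ++ [b])] }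
        else s
    | _ => s
  else s

/-- The symbol Bob sends in the even timestep of a round, given the erasure `e1` of
the odd timestep and the state `s` at the beginning of the round.  In the normal
phase (`rB < N/2`) he answers any non-⊥ reception with his (possibly just updated)
stored message and is silent upon ⊥; in the termination phase (`rB = N/2`) he answers
only a non-silent message of matching parity, and is silent otherwise. -/
def sentB (fA fB : List Bool → Bool) (N : ℕ) (e1 : Bool) (s : St) : Sym :=
  let r := recvB fA N e1 s
  if s.rB < N / 2 then
    match r with
    | none => Sym.sil
    | some _ =>
        let s' := bobUpd fB N r s
        Sym.msg s'.bsend (par s'.rB)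
  else
    match r with
    | some (Sym.msg _ p) => if p = par s.rB then Sym.msg s.bsend (par s.rB) else Sym.sil
    | _ => Sym.sil

/-- One round of the AGS coding scheme.  After Alice terminates (`rA = N/2`) her part
of the state is frozen and only Bob's part evolves (he keeps receiving silence, unless
erased). -/
def step (fA fB : List Bool → Bool) (N : ℕ) (e : Bool × Bool) (s : St) : St :=
  let r := recvB fA N e.1 s
  let sB := bobUpd fB N r s
  if s.rA < N / 2 then
    let mB := sentB fA fB N e.1 s
    let rcvA : Option Sym := if e.2 then none else some mB
    match rcvA with
    | none => { sB with rA := s.rA, abot := true }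
    | some (Sym.msg b p) =>
        if p = par (s.rA + 1) then
          { sB with TA := (s.TA ++ [fA s.TA]) ++ [b], rA := s.rA + 1, abot := false }
        else { sB with rA := s.rA, abot := false }
    | some Sym.sil => { sB with rA := s.rA, abot := false }
  else sB

/-- `exec fA fB N E k` is the state after `k` rounds have been played. -/
def exec (fA fB : List Bool → Bool) (N : ℕ) (E : ℕ → Bool × Bool) : ℕ → St
  | 0 => init
  | k + 1 => step fA fB N (E (k + 1)) (exec fA fB N E k)

/-- `stAt fA fB N E i` is the state at the beginning of round `i` (rounds 1-indexed):
for a protocol variable `v`, `v(i) = (stAt … i).v`. -/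
def stAt (fA fB : List Bool → Bool) (N : ℕ) (E : ℕ → Bool × Bool) (i : ℕ) : St :=
  exec fA fB N E (i - 1)

/-- The noiseless transcript of `π` after `r` rounds; `transcript fA fB (N/2)` is `T^π`. -/
def transcript (fA fB : List Bool → Bool) : ℕ → List Bool
  | 0 => []
  | r + 1 =>
    let t := transcript fA fB r
    (t ++ [fA t]) ++ [fB (t ++ [fA t])]

/-- `cA … i` : the number of rounds `j < i` in which Alice sent a non-silent message. -/
def cA (fA fB : List Bool → Bool) (N : ℕ) (E : ℕ → Bool × Bool) (i : ℕ) : ℕ :=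
  ((Finset.Ico 1 i).filter fun j => sentA fA N (stAt fA fB N E j) ≠ Sym.sil).card

/-- `cB … i` : the number of rounds `j < i` in which Bob sent a non-silent message. -/
def cB (fA fB : List Bool → Bool) (N : ℕ) (E : ℕ → Bool × Bool) (i : ℕ) : ℕ :=
  ((Finset.Ico 1 i).filter fun j =>
    sentB fA fB N (E j).1 (stAt fA fB N E j) ≠ Sym.sil).card

/-- `cch … i` : the total number of ⊥ receptions of Bob and of Alice in the rounds
before round `i` (Alice receives only while she is active). -/
def cch (fA fB : List Bool → Bool) (N : ℕ) (E : ℕ → Bool × Bool) (i : ℕ) : ℕ :=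
  ((Finset.Ico 1 i).filter fun j => (E j).1 = true).card +
  ((Finset.Ico 1 i).filter fun j =>
    (E j).2 = true ∧ (stAt fA fB N E j).rA < N / 2).card

theorem par_succ_ne (r : ℕ) : par r ≠ par (r + 1) := by
  simp only [par, ne_eq, decide_eq_decide]
  omega

/-- Bob's counter never decreases. -/
theorem rB_le_step (fA fB : List Bool → Bool) (N : ℕ) (e : Bool × Bool) (s : St) :
    s.rB ≤ (step fA fB N e s).rB := by
  simp only [step, bobUpd]
  grind

/-- The erasures counted by `cch` in a single round with erasures `e`, started in state `s`. -/
def roundErasures (N : ℕ) (e : Bool × Bool) (s : St) : ℕ :=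
  (if e.1 = true then 1 else 0) + (if e.2 = true ∧ s.rA < N / 2 then 1 else 0)

theorem cch_succ (fA fB : List Bool → Bool) (N : ℕ) (E : ℕ → Bool × Bool) (k : ℕ) :
    cch fA fB N E (k + 1 + 1) =
      cch fA fB N E (k + 1) + roundErasures N (E (k + 1)) (exec fA fB N E k) := by
  have hIco : Finset.Ico 1 (k + 1 + 1) = insert (k + 1) (Finset.Ico 1 (k + 1)) := by
    ext; simp
  simp only [cch, roundErasures, Finset.card_filter, hIco]
  rw [Finset.sum_insert (by simp), Finset.sum_insert (by simp)]
  simp only [stAt, Nat.add_sub_cancel]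
  omega

/-- The debt of a state: `1` when Alice is about to stay silent although Bob is not ahead of her,
so that even an erasure-free round makes no progress, and `0` otherwise. -/
def debt (s : St) : ℕ := if s.abot = true ∧ s.rB = s.rA then 1 else 0

/-- Bob is in step with Alice or exactly one round ahead of her. -/
def InSync (s : St) : Prop := s.rB = s.rA ∨ s.rB = s.rA + 1

theorem step_inSync_and_progress (fA fB : List Bool → Bool) (N : ℕ) (e : Bool × Bool) (s : St)
    (hB : s.rB < N / 2) (hs : InSync s) :
    InSync (step fA fB N e s) ∧
      s.rA + 1 + debt (step fA fB N e s) ≤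
        (step fA fB N e s).rA + roundErasures N e s + debt s := by
  obtain ⟨TA, rA, abot, TB, rB, bsend⟩ := s
  obtain ⟨e₁, e₂⟩ := e
  simp only [InSync] at hB hs
  have hA : rA < N / 2 := by omega
  have h₀ := par_succ_ne rA
  have h₁ := par_succ_ne (rA + 1)
  rcases hs with rfl | rfl <;> cases e₁ <;> cases e₂ <;> cases abot <;>
    simp [step, sentB, recvB, sentA, bobUpd, InSync, debt, roundErasures, hA, hB, h₀, h₁]

theorem exec_inSync_and_progress (fA fB : List Bool → Bool) (N : ℕ) (E : ℕ → Bool × Bool) (k : ℕ)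
    (hB : (exec fA fB N E k).rB < N / 2) :
    InSync (exec fA fB N E k) ∧
      k + debt (exec fA fB N E k) ≤ (exec fA fB N E k).rA + cch fA fB N E (k + 1) := by
  induction k with
  | zero => simp [exec, init, InSync, debt]
  | succ k ih =>
    have hB' : (exec fA fB N E k).rB < N / 2 := (rB_le_step fA fB N _ _).trans_lt hB
    obtain ⟨hs, hk⟩ := ih hB'
    obtain ⟨hs', hk'⟩ := step_inSync_and_progress fA fB N (E (k + 1)) _ hB' hs
    refine ⟨hs', ?_⟩
    rw [cch_succ]
    simp only [exec]
    omega

/-- Lemma 19 of the paper.  In any execution of the AGS scheme, for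
every round `i` at whose beginning Bob has not entered the termination phase
(`r_B(i) < N/2`), we have `r_A(i) ≥ (i − 1) − c_ch(i)`. -/
theorem ags_round_lower_bound
    (fA fB : List Bool → Bool) (N : ℕ) (hN : 0 < N) (hNeven : Even N)
    (E : ℕ → Bool × Bool)
    (i : ℕ) (hi : 1 ≤ i)
    (hBactive : (stAt fA fB N E i).rB < N / 2) :
    (stAt fA fB N E i).rA + cch fA fB N E i ≥ i - 1 := by
  obtain ⟨k, rfl⟩ : ∃ k, i = k + 1 := ⟨i - 1, by omega⟩
  have h := (exec_inSync_and_progress fA fB N E k hBactive).2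
  simp only [stAt, Nat.add_sub_cancel]
  omega

end AGS
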